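/- In the setting X := ℝ =: Y with fixed bounded s_j, t_i satisfying max{max_j sup|s_j|, max_i sup|t_i|} < 1, choose for each j distinct nodes x_1^j,…,x_{μ_j}^j ∈ K_j and for each i distinct nodes ξ_1^i,…,ξ_{ν_i}^i ∈ V_i, and let L_κ^j and L_λ^i denote the corresponding Lagrange basis polynomials (L_κ^j(x_{κ'}^j) = δ_{κκ'}, deg L_κ^j < μ_j, and similarly for L_λ^i). Define the fractal Lagrange interpolants 𝔏_κ^j := Θ(e_κ^j, 0) and 𝔏_λ^i := Θ(0, e_λ^i), where e_κ^j is the tuple in ×_j Π_{μ_j} whose j-th entry is L_κ^j and all other entries are zero, similarly e_λ^i, and Θ(p,q) is the fixed point f(p,q) of the affine RB operator. Then for all polynomial tuples p ∈ ×_j Π_{μ_j}, q ∈ ×_i Π_{ν_i}: f(p,q) = Σ_{j=1}^m Σ_{κ=1}^{μ_j} p_j(x_κ^j) 𝔏_κ^j + Σ_{i=1}^n Σ_{λ=1}^{ν_i} q_i(ξ_λ^i) 𝔏_λ^i. -/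

import Mathlib

open Bornology

/-- A bounded function whose size at each point is at most `σ < 1` times its size at some point
vanishes. -/
theorem eq_zero_of_bounded_of_contracting {g : ℝ → ℝ} {σ : ℝ} (hσ0 : 0 ≤ σ) (hσ : σ < 1)
    (hg : Memℓp g ⊤) (h : ∀ z, ∃ x, |g z| ≤ σ * |g x|) (z : ℝ) : g z = 0 := by
  obtain ⟨C, hC⟩ := memℓp_infty_iff.mp hg
  have hpow : ∀ (k : ℕ) (z : ℝ), |g z| ≤ σ ^ k * C := by
    intro k
    induction k with
    | zero => intro z; simpa using hC ⟨z, rfl⟩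
    | succ k ih =>
      intro z
      obtain ⟨x, hx⟩ := h z
      calc |g z| ≤ σ * |g x| := hx
        _ ≤ σ * (σ ^ k * C) := mul_le_mul_of_nonneg_left (ih x) hσ0
        _ = σ ^ (k + 1) * C := by ring
  have hlim : Filter.Tendsto (fun k : ℕ => σ ^ k * C) Filter.atTop (nhds 0) := by
    simpa using (tendsto_pow_atTop_nhds_zero_of_lt_one hσ0 hσ).mul_const C
  exact abs_nonpos_iff.mp (ge_of_tendsto' hlim fun k => hpow k z)

theorem memℓp_top_of_isBounded_range {f : ℝ → ℝ} (hf : IsBounded (Set.range f)) :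
    Memℓp f ⊤ := by
  obtain ⟨C, hC⟩ := hf.exists_norm_le
  refine memℓp_infty ⟨C, ?_⟩
  rintro _ ⟨z, rfl⟩
  exact hC _ ⟨z, rfl⟩

theorem Polynomial.isBounded_image_eval (r : Polynomial ℝ) {A : Set ℝ} (hA : IsBounded A) :
    IsBounded ((fun x => r.eval x) '' A) :=
  ((hA.isCompact_closure.image r.continuous).isBounded).subset (Set.image_mono subset_closure)

theorem Lagrange.sum_eval_mul_eval_basis {d : ℕ} {v : Fin d → ℝ} (hv : Function.Injective v)
    {r : Polynomial ℝ} (hr : r ∈ Polynomial.degreeLT ℝ d) (y : ℝ) :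
    ∑ κ, r.eval (v κ) * (Lagrange.basis Finset.univ v κ).eval y = r.eval y := by
  have hdeg : r.degree < (Finset.univ : Finset (Fin d)).card := by
    simpa using Polynomial.mem_degreeLT.mp hr
  conv_rhs => rw [Lagrange.eq_interpolate (s := Finset.univ) (v := v) hv.injOn hdeg]
  simp [Lagrange.interpolate_apply, Polynomial.eval_finsetSum]

theorem sum_sum_mul_ite_add {m : ℕ} {μ : Fin m → ℕ} (j : Fin m) (c : ℝ)
    (a L G : (k : Fin m) → Fin (μ k) → ℝ) :
    ∑ k, ∑ κ, a k κ * ((if j = k then L k κ else 0) + c * G k κ) =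
      ∑ κ, a j κ * L j κ + c * ∑ k, ∑ κ, a k κ * G k κ := by
  simp only [mul_add, Finset.sum_add_distrib, Finset.mul_sum]
  congr 1
  · rw [Finset.sum_eq_single j]
    · simp
    · intro k _ hk
      simp [hk.symm]
    · simp
  · exact Finset.sum_congr rfl fun k _ => Finset.sum_congr rfl fun κ _ => by ring

theorem sum_sum_mul_zero_add {m : ℕ} {μ : Fin m → ℕ} (c : ℝ)
    (a G : (k : Fin m) → Fin (μ k) → ℝ) :
    ∑ k, ∑ κ, a k κ * (0 + c * G k κ) = c * ∑ k, ∑ κ, a k κ * G k κ := by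
  simp only [zero_add, Finset.mul_sum]
  exact Finset.sum_congr rfl fun k _ => Finset.sum_congr rfl fun κ _ => by ring

/-- In the setting `X = Y = ℝ` with fixed `s, t` bounded by a common `σ < 1`,
choose distinct nodes `x_κ^j ∈ K j` and `ξ_λ^i ∈ V i` and let `L_κ^j`, `L_λ^i` be the
corresponding Lagrange basis polynomials.  Defining the fractal Lagrange interpolants
`𝔏_κ^j := Θ(e_κ^j, 0)` and `𝔏_λ^i := Θ(0, e_λ^i)`, every fixed point of an affine RB operator
with polynomial tuples `p`, `q` (degrees `< μ j`, `< ν i`) has the representation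
`f(p,q) = Σ_j Σ_κ p_j(x_κ^j) 𝔏_κ^j + Σ_i Σ_λ q_i(ξ_λ^i) 𝔏_λ^i`. -/
theorem fractal_Lagrange_representation {m n : ℕ}
    (K : Set ℝ) (Kj : Fin m → Set ℝ) (V : Fin n → Set ℝ)
    (hKjbdd : ∀ j, IsBounded (Kj j)) (hVbdd : ∀ i, IsBounded (V i))
    (b : Fin m → ℝ → ℝ) (u : Fin n → ℝ → ℝ)
    (hbinj : ∀ j, Set.InjOn (b j) (Kj j)) (huinj : ∀ i, Set.InjOn (u i) (V i))
    (hKcov : (⋃ j, b j '' Kj j) = K)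
    (hVcov : (⋃ i, u i '' V i) = Set.univ \ K)
    (hdisj : Pairwise (Function.onFun Disjoint
      (Sum.elim (fun j : Fin m => b j '' Kj j) (fun i : Fin n => u i '' V i))))
    (S : Fin m → ℝ → ℝ) (T : Fin n → ℝ → ℝ)
    (σ : ℝ) (hσ0 : 0 ≤ σ) (hσ : σ < 1)
    (hS : ∀ j, ∀ x ∈ Kj j, |S j x| ≤ σ) (hT : ∀ i, ∀ x ∈ V i, |T i x| ≤ σ)
    (μ : Fin m → ℕ) (ν : Fin n → ℕ)
    (xn : (j : Fin m) → Fin (μ j) → ℝ) (ξ : (i : Fin n) → Fin (ν i) → ℝ)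
    (hxn_mem : ∀ j κ, xn j κ ∈ Kj j) (hξ_mem : ∀ i lam, ξ i lam ∈ V i)
    (hxn_inj : ∀ j, Function.Injective (xn j)) (hξ_inj : ∀ i, Function.Injective (ξ i))
    -- `F P Q` is the unique bounded fixed point of the affine RB operator `Φ(P)(Q)(S)(T)`
    (F : (Fin m → ℝ → ℝ) → (Fin n → ℝ → ℝ) → (ℝ → ℝ))
    (hF : ∀ (P : Fin m → ℝ → ℝ) (Q : Fin n → ℝ → ℝ),
      (∀ j, IsBounded (P j '' Kj j)) → (∀ i, IsBounded (Q i '' V i)) →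
      IsBounded (Set.range (F P Q)) ∧
      (∀ j, ∀ x ∈ Kj j, F P Q (b j x) = P j x + S j x * F P Q x) ∧
      (∀ i, ∀ x ∈ V i, F P Q (u i x) = Q i x + T i x * F P Q x))
    (p : Fin m → Polynomial ℝ) (q : Fin n → Polynomial ℝ)
    (hp : ∀ j, p j ∈ Polynomial.degreeLT ℝ (μ j)) (hq : ∀ i, q i ∈ Polynomial.degreeLT ℝ (ν i)) :
    F (fun j x => (p j).eval x) (fun i x => (q i).eval x) = fun z =>
      (∑ j, ∑ κ, (p j).eval (xn j κ) *
        F (fun j' y => if j' = j then (Lagrange.basis Finset.univ (xn j) κ).eval y else 0)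
          (fun _ _ => 0) z) +
      (∑ i, ∑ lam, (q i).eval (ξ i lam) *
        F (fun _ _ => 0)
          (fun i' y => if i' = i then (Lagrange.basis Finset.univ (ξ i) lam).eval y else 0) z) := by
  have hzeroK : ∀ j : Fin m, IsBounded ((fun _ : ℝ => (0 : ℝ)) '' Kj j) := fun j => by
    simpa using Polynomial.isBounded_image_eval 0 (hKjbdd j)
  have hzeroV : ∀ i : Fin n, IsBounded ((fun _ : ℝ => (0 : ℝ)) '' V i) := fun i => by
    simpa using Polynomial.isBounded_image_eval 0 (hVbdd i)
  obtain ⟨hF_bdd, hF_b, hF_u⟩ := hF (fun j x => (p j).eval x) (fun i x => (q i).eval x)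
    (fun j => (p j).isBounded_image_eval (hKjbdd j))
    (fun i => (q i).isBounded_image_eval (hVbdd i))
  have hG := fun j κ => hF
    (fun j' y => if j' = j then (Lagrange.basis Finset.univ (xn j) κ).eval y else 0)
    (fun _ _ => 0)
    (fun j' => by
      by_cases h : j' = j
      · simpa only [h, if_true] using Polynomial.isBounded_image_eval _ (hKjbdd j)
      · simpa only [h, if_false] using hzeroK j')
    hzeroV
  have hH := fun i lam => hF (fun _ _ => 0)
    (fun i' y => if i' = i then (Lagrange.basis Finset.univ (ξ i) lam).eval y else 0)
    hzeroK
    (fun i' => by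
      by_cases h : i' = i
      · simpa only [h, if_true] using Polynomial.isBounded_image_eval _ (hVbdd i)
      · simpa only [h, if_false] using hzeroV i')
  generalize F (fun j x => (p j).eval x) (fun i x => (q i).eval x) = f at *
  set G : (j : Fin m) → Fin (μ j) → ℝ → ℝ := fun j κ =>
    F (fun j' y => if j' = j then (Lagrange.basis Finset.univ (xn j) κ).eval y else 0)
      (fun _ _ => 0)
  set H : (i : Fin n) → Fin (ν i) → ℝ → ℝ := fun i lam =>
    F (fun _ _ => 0)
      (fun i' y => if i' = i then (Lagrange.basis Finset.univ (ξ i) lam).eval y else 0)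
  change ∀ j κ, IsBounded (Set.range (G j κ)) ∧
    (∀ k, ∀ x ∈ Kj k, G j κ (b k x) =
      (if k = j then (Lagrange.basis Finset.univ (xn j) κ).eval x else 0) + S k x * G j κ x) ∧
    (∀ k, ∀ x ∈ V k, G j κ (u k x) = 0 + T k x * G j κ x) at hG
  change ∀ i lam, IsBounded (Set.range (H i lam)) ∧
    (∀ k, ∀ x ∈ Kj k, H i lam (b k x) = 0 + S k x * H i lam x) ∧
    (∀ k, ∀ x ∈ V k, H i lam (u k x) =
      (if k = i then (Lagrange.basis Finset.univ (ξ i) lam).eval x else 0)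
        + T k x * H i lam x) at hH
  change f = fun z => (∑ j, ∑ κ, (p j).eval (xn j κ) * G j κ z) +
    ∑ i, ∑ lam, (q i).eval (ξ i lam) * H i lam z
  clear_value G H
  funext z
  rw [← sub_eq_zero]
  refine eq_zero_of_bounded_of_contracting
    (g := fun z => f z - ((∑ j, ∑ κ, (p j).eval (xn j κ) * G j κ z) +
      ∑ i, ∑ lam, (q i).eval (ξ i lam) * H i lam z)) hσ0 hσ ?_ ?_ z
  · refine (memℓp_top_of_isBounded_range hF_bdd).sub (Memℓp.add ?_ ?_)
    · exact Memℓp.finsetSum _ fun j _ => Memℓp.finsetSum _ fun κ _ =>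
        (memℓp_top_of_isBounded_range (hG j κ).1).const_mul _
    · exact Memℓp.finsetSum _ fun i _ => Memℓp.finsetSum _ fun lam _ =>
        (memℓp_top_of_isBounded_range (hH i lam).1).const_mul _
  · intro z
    by_cases hz : z ∈ K
    · rw [← hKcov] at hz
      obtain ⟨j, x, hx, rfl⟩ := Set.mem_iUnion.mp hz
      refine ⟨x, le_of_eq_of_le ?_ (mul_le_mul_of_nonneg_right (hS j x hx) (abs_nonneg _))⟩
      rw [← abs_mul]
      congr 1
      simp only [hF_b j x hx, fun k κ => (hG k κ).2.1 j x hx, fun k lam => (hH k lam).2.1 j x hx]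
      rw [sum_sum_mul_ite_add, sum_sum_mul_zero_add,
        Lagrange.sum_eval_mul_eval_basis (hxn_inj j) (hp j)]
      ring
    · have hz' : z ∈ Set.univ \ K := ⟨trivial, hz⟩
      rw [← hVcov] at hz'
      obtain ⟨i, x, hx, rfl⟩ := Set.mem_iUnion.mp hz'
      refine ⟨x, le_of_eq_of_le ?_ (mul_le_mul_of_nonneg_right (hT i x hx) (abs_nonneg _))⟩
      rw [← abs_mul]
      congr 1
      simp only [hF_u i x hx, fun k κ => (hG k κ).2.2 i x hx, fun k lam => (hH k lam).2.2 i x hx]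
      rw [sum_sum_mul_ite_add, sum_sum_mul_zero_add,
        Lagrange.sum_eval_mul_eval_basis (hξ_inj i) (hq i)]
      ring
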